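/- (Harmonic decomposition of Φ ⊗̄ Φ as quadratic forms.) For all symmetric real 3×3 matrices Φ and X, with deviators Φ′ = Φ − (1/3)(tr Φ) Id and X′ = X − (1/3)(tr X) Id, the following identity holds: tr(ΦXΦX) = (1/9)tr(Φ²)(tr X)² + (1/30)[tr(Φ²) + 3(tr Φ)²] tr(X′²) + (2/3)(tr X) tr((Φ²)′X′) + (6/7)(tr Φ) tr(Φ′X′²) − (2/7)tr((Φ²)′X′²) + (1/3)(tr(Φ′X′))² + (2/3)tr(X′Φ′X′Φ′) − (8/21)tr(Φ′²X′²) + (4/105)tr(Φ′²) tr(X′²). -/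

import Mathlib

open Matrix

/-- **Harmonic decomposition of `Φ ⊗̄ Φ` as quadratic forms.** For all symmetric 3×3 matrices
`Φ` and `X`, with deviators `Φ′`, `X′` and `(Φ²)′`, one has
`tr(ΦXΦX) = (1/9)tr(Φ²)(tr X)² + (1/30)[tr(Φ²)+3(tr Φ)²]tr(X′²) + (2/3)(tr X)tr((Φ²)′X′)`
`+ (6/7)(tr Φ)tr(Φ′X′²) − (2/7)tr((Φ²)′X′²) + (1/3)(tr(Φ′X′))² + (2/3)tr(X′Φ′X′Φ′)`
`− (8/21)tr(Φ′²X′²) + (4/105)tr(Φ′²)tr(X′²)`. -/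
theorem harmonic_decomposition_Phi_obar_Phi
    (Φ X : Matrix (Fin 3) (Fin 3) ℝ) (hΦ : Φ.IsSymm) (hX : X.IsSymm)
    (Φ' X' Φsq' : Matrix (Fin 3) (Fin 3) ℝ)
    (hΦ' : Φ' = Φ - (Φ.trace / 3) • (1 : Matrix (Fin 3) (Fin 3) ℝ))
    (hX' : X' = X - (X.trace / 3) • (1 : Matrix (Fin 3) (Fin 3) ℝ))
    (hΦsq' : Φsq' = Φ * Φ - ((Φ * Φ).trace / 3) • (1 : Matrix (Fin 3) (Fin 3) ℝ)) :
    (Φ * X * Φ * X).trace =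
      1 / 9 * (Φ * Φ).trace * X.trace ^ 2
        + 1 / 30 * ((Φ * Φ).trace + 3 * Φ.trace ^ 2) * (X' * X').trace
        + 2 / 3 * X.trace * (Φsq' * X').trace
        + 6 / 7 * Φ.trace * (Φ' * (X' * X')).trace
        - 2 / 7 * (Φsq' * (X' * X')).trace
        + 1 / 3 * (Φ' * X').trace ^ 2
        + 2 / 3 * (X' * Φ' * X' * Φ').trace
        - 8 / 21 * (Φ' * Φ' * (X' * X')).trace
        + 4 / 105 * (Φ' * Φ').trace * (X' * X').trace := by
  subst hΦ' hX' hΦsq'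
  have hΦ₁ : Φ 1 0 = Φ 0 1 := hΦ.apply 0 1
  have hΦ₂ : Φ 2 0 = Φ 0 2 := hΦ.apply 0 2
  have hΦ₃ : Φ 2 1 = Φ 1 2 := hΦ.apply 1 2
  have hX₁ : X 1 0 = X 0 1 := hX.apply 0 1
  have hX₂ : X 2 0 = X 0 2 := hX.apply 0 2
  have hX₃ : X 2 1 = X 1 2 := hX.apply 1 2
  simp [Matrix.trace_fin_three, Matrix.mul_apply, Fin.sum_univ_three, Matrix.one_apply,
    hΦ₁, hΦ₂, hΦ₃, hX₁, hX₂, hX₃]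
  ring
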